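/- The center of R is k; that is, an element of R commutes with every element of R if and only if it is a scalar multiple of the identity. -/

import Mathlib

/-!
`R = k⟨x,y⟩/⟨yx − 1⟩` is the associative `k`-algebra generated by `x` and `y`
with the single defining relation `y * x = 1` (the one-sided inverse of `k[x]`).
We realize it as the `RingQuot` of the free algebra on two generators.
-/

noncomputable section

/-- The defining relation `y * x = 1` on the free algebra `k⟨x,y⟩`. -/
inductive PreRel (k : Type) [Field k] : FreeAlgebra k (Fin 2) → FreeAlgebra k (Fin 2) → Prop
  | yx : PreRel k (FreeAlgebra.ι k 1 * FreeAlgebra.ι k 0) 1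

/-- `R = k⟨x,y⟩/⟨yx − 1⟩`. -/
abbrev R (k : Type) [Field k] := RingQuot (PreRel k)

/-- The generator `x` of `R`. -/
def Xg (k : Type) [Field k] : R k := RingQuot.mkAlgHom k (PreRel k) (FreeAlgebra.ι k 0)

/-- The generator `y` of `R`. -/
def Yg (k : Type) [Field k] : R k := RingQuot.mkAlgHom k (PreRel k) (FreeAlgebra.ι k 1)

theorem YX (k : Type) [Field k] : Yg k * Xg k = 1 := by
  have h := RingQuot.mkAlgHom_rel k (PreRel.yx (k := k))
  rw [map_mul, map_one] at h
  exact h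

/-- The monomials `x^i y^j`. -/
def mon (k : Type) [Field k] (p : ℕ × ℕ) : R k := Xg k ^ p.1 * Yg k ^ p.2

theorem mul_mem_S (k : Type) [Field k] (a : FreeAlgebra k (Fin 2)) :
    ∀ s ∈ Submodule.span k (Set.range (mon k)),
      RingQuot.mkAlgHom k (PreRel k) a * s ∈ Submodule.span k (Set.range (mon k)) := by
  induction a using FreeAlgebra.induction with
  | grade0 c =>
    intro s hs
    rw [AlgHom.commutes, ← Algebra.smul_def]
    exact Submodule.smul_mem _ _ hs
  | grade1 i =>
    intro s hs
    induction hs using Submodule.span_induction with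
    | zero => simp
    | add u v _ _ hu hv => rw [mul_add]; exact add_mem hu hv
    | smul c u _ hu => rw [mul_smul_comm]; exact Submodule.smul_mem _ _ hu
    | mem u hu =>
      obtain ⟨⟨m, n⟩, rfl⟩ := hu
      fin_cases i
      · refine Submodule.subset_span ⟨(m + 1, n), ?_⟩
        change Xg k ^ (m + 1) * Yg k ^ n = Xg k * (Xg k ^ m * Yg k ^ n)
        rw [pow_succ', mul_assoc]
      · cases m with
        | zero =>
          refine Submodule.subset_span ⟨(0, n + 1), ?_⟩
          change Xg k ^ 0 * Yg k ^ (n + 1) = Yg k * (Xg k ^ 0 * Yg k ^ n)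
          rw [pow_zero, one_mul, one_mul, pow_succ']
        | succ m =>
          refine Submodule.subset_span ⟨(m, n), ?_⟩
          change Xg k ^ m * Yg k ^ n = Yg k * (Xg k ^ (m + 1) * Yg k ^ n)
          rw [pow_succ', mul_assoc, ← mul_assoc (Yg k), YX, one_mul]
  | mul a b ha hb =>
    intro s hs
    rw [map_mul, mul_assoc]
    exact ha _ (hb _ hs)
  | add a b ha hb =>
    intro s hs
    rw [map_add, add_mul]
    exact add_mem (ha _ hs) (hb _ hs)

theorem mem_S (k : Type) [Field k] (r : R k) : r ∈ Submodule.span k (Set.range (mon k)) := by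
  obtain ⟨a, rfl⟩ := RingQuot.mkAlgHom_surjective k (PreRel k) r
  have := mul_mem_S k a 1 (Submodule.subset_span ⟨(0, 0), by simp [mon]⟩)
  rwa [mul_one] at this

/-- Division by `X` as a linear map. -/
def dX (k : Type) [Field k] : Module.End k (Polynomial k) where
  toFun p := p.divX
  map_add' _ _ := Polynomial.divX_add
  map_smul' _ _ := by ext; simp [Polynomial.coeff_divX]

/-- The action on the polynomials. -/
def rho (k : Type) [Field k] : R k →ₐ[k] Module.End k (Polynomial k) :=
  RingQuot.liftAlgHom k ⟨FreeAlgebra.lift k ![LinearMap.mulLeft k Polynomial.X, dX k], by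
    rintro _ _ ⟨⟩
    refine LinearMap.ext fun p => ?_
    simp only [map_mul, map_one, FreeAlgebra.lift_ι_apply, Module.End.mul_apply,
      Module.End.one_apply]
    change (Polynomial.X * p).divX = p
    ext n
    simp [Polynomial.coeff_divX]⟩

theorem rho_X (k : Type) [Field k] (p : Polynomial k) :
    rho k (Xg k) p = Polynomial.X * p := by
  simp [rho, Xg]

theorem rho_Y (k : Type) [Field k] (p : Polynomial k) :
    rho k (Yg k) p = p.divX := by
  simp [rho, Yg, dX]

theorem rho_Xpow (k : Type) [Field k] (n : ℕ) (p : Polynomial k) :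
    rho k (Xg k ^ n) p = Polynomial.X ^ n * p := by
  induction n with
  | zero => simp
  | succ n ih => rw [pow_succ', map_mul, Module.End.mul_apply, ih, rho_X, pow_succ', mul_assoc]

theorem rho_Ypow (k : Type) [Field k] (n m : ℕ) (p : Polynomial k) :
    (rho k (Yg k ^ n) p).coeff m = p.coeff (m + n) := by
  induction n generalizing m with
  | zero => simp
  | succ n ih =>
    rw [pow_succ', map_mul, Module.End.mul_apply, rho_Y, Polynomial.coeff_divX, ih]
    congr 1
    omega

theorem rho_mon (k : Type) [Field k] (i j m n : ℕ) :
    (rho k (mon k (i, j)) (Polynomial.X ^ n)).coeff m =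
      if i ≤ m ∧ m + j = n + i then 1 else 0 := by
  rw [mon, map_mul, Module.End.mul_apply, rho_Xpow, Polynomial.coeff_X_pow_mul', rho_Ypow,
    Polynomial.coeff_X_pow]
  by_cases h : i ≤ m
  · have : m - i + j = n ↔ m + j = n + i := by omega
    simp [h, this]
  · simp [h]

theorem rho_inj (k : Type) [Field k] (r : R k) (h : ∀ n, rho k r (Polynomial.X ^ n) = 0) :
    r = 0 := by
  obtain ⟨c, rfl⟩ := (Finsupp.mem_span_range_iff_exists_finsupp).1 (mem_S k r)
  have key : ∀ n m, c (m, n) = 0 := by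
    intro n
    induction n using Nat.strong_induction_on with
    | _ n ih =>
      intro m
      have h1 := congrArg (fun p => Polynomial.coeff p m) (h n)
      simp only [Finsupp.sum, map_sum, map_smul, LinearMap.sum_apply, LinearMap.smul_apply,
        Polynomial.finsetSum_coeff, Polynomial.coeff_smul, Polynomial.coeff_zero] at h1
      rw [Finset.sum_eq_single (m, n)] at h1
      · simpa [rho_mon, add_comm m n] using h1
      · rintro ⟨i, j⟩ _ hne
        rw [rho_mon]
        by_cases hj : j < n
        · rw [ih j hj, zero_smul]
        · rw [if_neg, smul_zero]
          rintro ⟨h2, h3⟩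
          apply hne
          ext <;> simp <;> omega
      · intro hn
        rw [Finsupp.notMem_support_iff.1 hn, zero_smul]
  have : c = 0 := by
    ext ⟨m, n⟩
    exact key n m
  simp [this]

/-- the center of `R` is `k`: an element of `R` commutes with every
element of `R` if and only if it is a scalar multiple of the identity. -/
theorem center_eq_scalars (k : Type) [Field k] (r : R k) :
    (∀ s : R k, r * s = s * r) ↔ ∃ c : k, r = algebraMap k (R k) c := by
  constructor
  · intro h
    refine ⟨(rho k r 1).coeff 0, ?_⟩
    have h0 : rho k r 1 = Polynomial.C ((rho k r 1).coeff 0) := by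
      have h1 := congrArg (fun s => rho k s 1) (h (Xg k * Yg k))
      simp only [map_mul, Module.End.mul_apply, rho_X, rho_Y, Polynomial.divX_one, mul_zero,
        map_zero] at h1
      have h2 := Polynomial.X_mul_divX_add (rho k r 1)
      rw [← h1, zero_add] at h2
      exact h2.symm
    rw [← sub_eq_zero]
    apply rho_inj
    intro n
    have h1 := congrArg (fun s => rho k s 1) (h (Xg k ^ n))
    simp only [map_mul, Module.End.mul_apply, rho_Xpow, mul_one] at h1
    rw [map_sub, LinearMap.sub_apply, h1, AlgHom.commutes, Module.algebraMap_end_apply,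
      sub_eq_zero, Polynomial.smul_eq_C_mul, ← h0, mul_comm]
  · rintro ⟨c, rfl⟩ s
    exact Algebra.commutes c s
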